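/- Assume J_ρ ≠ 𝒥, let J ⊆ 𝒥 and let j ∉ J_ρ. Then #{i ≥ 0 : j+1 ∈ δ_ss^i(J)} − #{i ≥ 0 : j+1 ∈ δ_ss^i(J^{ss})} = 1_{j+k(j)+1 ∈ J} (both sets being finite). -/

import Mathlib

open Finset
open scoped symmDiff

def shiftSet (f : ℕ) (J : Finset (ZMod f)) (k : ℤ) : Finset (ZMod f) :=
  J.image (fun j => j + (k : ZMod f))

def deltaSS (f : ℕ) (Jrho J : Finset (ZMod f)) : Finset (ZMod f) :=
  shiftSet f J (-1) ∩ Jrho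

def sfun (p f : ℕ) (r : ZMod f → ℤ) (Jrho J : Finset (ZMod f)) (j : ZMod f) : ℤ :=
  if j ∈ J then
    if j + 1 ∈ J then (if j ∈ Jrho then (p : ℤ) - 3 - r j else (p : ℤ) - 1 - r j)
    else r j + 1
  else
    if j + 1 ∈ J then (p : ℤ) - 2 - r j else r j

def tfun (f : ℕ) (r : ZMod f → ℤ) (Jrho J : Finset (ZMod f)) (j : ZMod f) : ℤ :=
  if j ∈ J then
    if j + 1 ∈ J then (if j ∈ Jrho then r j + 1 else r j)
    else -1
  else
    if j + 1 ∈ J then r j + 1 else 0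


theorem mem_deltaSS {f : ℕ} {Jrho J : Finset (ZMod f)} {x : ZMod f} :
    x ∈ deltaSS f Jrho J ↔ x + 1 ∈ J ∧ x ∈ Jrho := by
  simp [deltaSS, shiftSet, ← sub_eq_add_neg, sub_eq_iff_eq_add]

theorem mem_iterate_deltaSS {f : ℕ} {Jrho J : Finset (ZMod f)} {x : ZMod f} {i : ℕ} :
    x ∈ (deltaSS f Jrho)^[i] J ↔ x + (i : ZMod f) ∈ J ∧ ∀ m < i, x + (m : ZMod f) ∈ Jrho := by
  induction i generalizing x with
  | zero => simp
  | succ n ih =>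
    rw [Function.iterate_succ_apply', mem_deltaSS, ih, Nat.forall_lt_succ_left']
    simp only [Nat.cast_add, Nat.cast_one, Nat.cast_zero, add_zero, add_assoc,
      add_comm (1 : ZMod f)]
    tauto

/-- If `k` is the length of the run of elements of `Jrho` starting at `x`, then `x` can only lie
in the first `k + 1` iterates of `deltaSS`. -/
theorem setOf_mem_iterate_deltaSS {f : ℕ} {Jrho : Finset (ZMod f)} {x : ZMod f} {k : ℕ}
    (hmem : ∀ m < k, x + (m : ZMod f) ∈ Jrho) (hk : x + (k : ZMod f) ∉ Jrho)
    (J : Finset (ZMod f)) :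
    {i : ℕ | x ∈ (deltaSS f Jrho)^[i] J} =
      ((range (k + 1)).filter fun i => x + (i : ZMod f) ∈ J : Finset ℕ) := by
  ext i
  simp only [Set.mem_ofPred_eq, mem_iterate_deltaSS, coe_filter, mem_range, Order.lt_add_one_iff]
  rw [and_comm]
  refine and_congr_left fun _ => ⟨fun h => ?_, fun h m hm => hmem m (hm.trans_le h)⟩
  by_contra! hlt
  exact hk (h k hlt)

theorem statement12 (f : ℕ) [NeZero f] (hf : 1 ≤ f) (Jrho : Finset (ZMod f))
    (hJrho : Jrho ≠ Finset.univ)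
    (J : Finset (ZMod f)) (j : ZMod f) (hj : j ∉ Jrho)
    (k : ℕ) (hkf : k < f)
    (hk1 : ∀ i : ℕ, 1 ≤ i → i ≤ k → j + (i : ZMod f) ∈ Jrho)
    (hk2 : j + (k : ZMod f) + 1 ∉ Jrho) :
    {i : ℕ | j + 1 ∈ (deltaSS f Jrho)^[i] J}.Finite ∧
    {i : ℕ | j + 1 ∈ (deltaSS f Jrho)^[i] (J ∩ Jrho)}.Finite ∧
    ({i : ℕ | j + 1 ∈ (deltaSS f Jrho)^[i] J}.ncard : ℤ)
      - ({i : ℕ | j + 1 ∈ (deltaSS f Jrho)^[i] (J ∩ Jrho)}.ncard : ℤ)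
      = (if j + (k : ZMod f) + 1 ∈ J then 1 else 0) := by
  have hmem : ∀ m < k, j + 1 + (m : ZMod f) ∈ Jrho := fun m hm => by
    have := hk1 (m + 1) (by omega) (by omega)
    rwa [Nat.cast_add, Nat.cast_one, add_comm (m : ZMod f), ← add_assoc] at this
  rw [add_right_comm] at hk2 ⊢
  have hfilter : ((range k).filter fun i : ℕ => j + 1 + (i : ZMod f) ∈ J ∩ Jrho) =
      (range k).filter fun i : ℕ => j + 1 + (i : ZMod f) ∈ J :=
    filter_congr fun i hi => by simp [hmem i (mem_range.mp hi)]
  rw [setOf_mem_iterate_deltaSS hmem hk2, setOf_mem_iterate_deltaSS hmem hk2]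
  refine ⟨finite_toSet _, finite_toSet _, ?_⟩
  rw [Set.ncard_coe_finset, Set.ncard_coe_finset, range_add_one, filter_insert, filter_insert,
    if_neg (fun h => hk2 (mem_inter.mp h).2), hfilter]
  split_ifs <;> simp
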